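/- Let Ã, R, λ, σ₁, σ₃ be as given, and let X ⊆ R be the 16-element set {1, σ₁, z₂, z₃, σ₁², σ₁z₂, σ₁z₃, z₂z₃, σ₁³, σ₁²z₂, σ₁²z₃, σ₃, σ₁⁴, σ₁³z₂, σ₁³z₃, σ₁⁴z₂}. Then R is a free Ã-module of rank 48 (with Ã acting through λ), and the 48 elements {x, x·r, x·r² : x ∈ X} form an Ã-basis of R. -/

import Mathlib

open MvPolynomial

instance : (Ideal.span {(3 : ℤ)}).IsPrime :=
  (Ideal.span_singleton_prime (by norm_num)).mpr Int.prime_three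

/-- The ring `ℤ_(3)`, the localization of `ℤ` at the prime ideal `(3)`. -/
def Z3loc : Type := Localization.AtPrime (Ideal.span {(3 : ℤ)})

noncomputable instance : CommRing Z3loc :=
  inferInstanceAs (CommRing (Localization.AtPrime (Ideal.span {(3 : ℤ)})))

/-- The polynomial ring `Ã = ℤ_(3)[ā₂,ā₄,ā₆]`. -/
noncomputable abbrev Atilde : Type := MvPolynomial (Fin 3) Z3loc

/-- The ring `R = ℤ_(3)[z₁,z₂,z₃,r]/(z₁z₂+z₂z₃+z₃z₁)`; the variables `X 0, X 1, X 2, X 3`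
are `z₁, z₂, z₃, r` respectively. -/
noncomputable abbrev Rring : Type :=
  MvPolynomial (Fin 4) Z3loc ⧸
    (Ideal.span {(X 0 * X 1 + X 1 * X 2 + X 2 * X 0 : MvPolynomial (Fin 4) Z3loc)})

/-- The images of the variables `z₁, z₂, z₃, r` in `R`. -/
noncomputable def zR (i : Fin 4) : Rring := Ideal.Quotient.mk _ (X i)

/-- `σ₁ = z₁+z₂+z₃` in `R`. -/
noncomputable def σ₁R : Rring := zR 0 + zR 1 + zR 2

/-- `σ₃ = z₁z₂z₃` in `R`. -/
noncomputable def σ₃R : Rring := zR 0 * zR 1 * zR 2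

/-- `λ(ā₂) = (1/4)(z₁−z₂+z₃)² − z₂z₃ − 3r`  (note `4` is a unit in `ℤ_(3)`). -/
noncomputable def la2 : Rring :=
  Ring.inverse (4 : Rring) * (zR 0 - zR 1 + zR 2) ^ 2 - zR 1 * zR 2 - 3 * zR 3

/-- `λ(ā₄) = (1/2)z₁z₃²(z₁−z₂+z₃) − 2r·λ(ā₂) − 3r²`. -/
noncomputable def la4 : Rring :=
  Ring.inverse (2 : Rring) * (zR 0 * zR 2 ^ 2 * (zR 0 - zR 1 + zR 2))
    - 2 * zR 3 * la2 - 3 * zR 3 ^ 2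

/-- `λ(ā₆) = (1/4)z₁²z₃⁴ − r·λ(ā₄) − r²·λ(ā₂) − r³`. -/
noncomputable def la6 : Rring :=
  Ring.inverse (4 : Rring) * (zR 0 ^ 2 * zR 2 ^ 4)
    - zR 3 * la4 - zR 3 ^ 2 * la2 - zR 3 ^ 3

/-- The `ℤ_(3)`-algebra map `λ : Ã → R`, `ā₂ ↦ λ(ā₂)`, `ā₄ ↦ λ(ā₄)`, `ā₆ ↦ λ(ā₆)`. -/
noncomputable def lam : Atilde →ₐ[Z3loc] Rring :=
  MvPolynomial.aeval ![la2, la4, la6]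

/-- `n₄ = σ₁²r − z₁³z₃ − z₁z₂³ − z₁²z₃²`. -/
noncomputable def n4R : Rring :=
  σ₁R ^ 2 * zR 3 - zR 0 ^ 3 * zR 2 - zR 0 * zR 1 ^ 3 - zR 0 ^ 2 * zR 2 ^ 2

/-- `n₆ = σ₁²r² − 2z₁³z₃r − 2z₁z₂³r − 2z₁²z₃²r + 2z₁³z₃³ − z₁²z₃⁴`. -/
noncomputable def n6R : Rring :=
  σ₁R ^ 2 * zR 3 ^ 2 - 2 * zR 0 ^ 3 * zR 2 * zR 3 - 2 * zR 0 * zR 1 ^ 3 * zR 3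
    - 2 * zR 0 ^ 2 * zR 2 ^ 2 * zR 3 + 2 * zR 0 ^ 3 * zR 2 ^ 3 - zR 0 ^ 2 * zR 2 ^ 4

/-- The `16`-element family
`X = {1, σ₁, z₂, z₃, σ₁², σ₁z₂, σ₁z₃, z₂z₃, σ₁³, σ₁²z₂, σ₁²z₃, σ₃, σ₁⁴, σ₁³z₂, σ₁³z₃, σ₁⁴z₂}`. -/
noncomputable def Xfam : Fin 16 → Rring :=
  ![1, σ₁R, zR 1, zR 2,
    σ₁R ^ 2, σ₁R * zR 1, σ₁R * zR 2, zR 1 * zR 2,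
    σ₁R ^ 3, σ₁R ^ 2 * zR 1, σ₁R ^ 2 * zR 2, σ₃R,
    σ₁R ^ 4, σ₁R ^ 3 * zR 1, σ₁R ^ 3 * zR 2, σ₁R ^ 4 * zR 1]



instance : IsLocalRing Z3loc :=
  inferInstanceAs (IsLocalRing (Localization.AtPrime (Ideal.span {(3 : ℤ)})))

theorem three_mem_max : (3 : Z3loc) ∈ IsLocalRing.maximalIdeal Z3loc := by
  have h := (IsLocalization.AtPrime.to_map_mem_maximal_iff
    (Localization.AtPrime (Ideal.span {(3 : ℤ)})) (Ideal.span {(3 : ℤ)}) 3).2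
    (Ideal.mem_span_singleton_self 3)
  rw [map_ofNat] at h
  exact h

theorem isUnit_two : IsUnit (2 : Z3loc) := by
  have h := (IsLocalization.AtPrime.isUnit_to_map_iff
    (Localization.AtPrime (Ideal.span {(3 : ℤ)})) (Ideal.span {(3 : ℤ)}) 2).2
    (by
      change ¬ ((2 : ℤ) ∈ Ideal.span {(3 : ℤ)})
      rw [Ideal.mem_span_singleton]
      norm_num)
  rw [map_ofNat] at h
  exact h

theorem isUnit_twoR : IsUnit (2 : Rring) := by
  have h := isUnit_two.map (algebraMap Z3loc Rring)
  rwa [map_ofNat] at h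

theorem isUnit_fourR : IsUnit (4 : Rring) := by
  have h := isUnit_twoR.mul isUnit_twoR
  norm_num at h
  exact h

theorem rel : zR 0 * zR 1 + zR 1 * zR 2 + zR 2 * zR 0 = 0 := by
  unfold zR
  rw [← map_mul, ← map_mul, ← map_mul, ← map_add, ← map_add, Ideal.Quotient.eq_zero_iff_mem]
  exact Ideal.mem_span_singleton_self _

/-- span of the monomials of weight `d`. -/
noncomputable def Fsub (d : ℕ) : Submodule Z3loc Rring :=
  Submodule.span Z3loc {x | ∃ a b c e : ℕ, a + b + c + 2 * e = d ∧
    x = zR 0 ^ a * zR 1 ^ b * zR 2 ^ c * zR 3 ^ e}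

/-- span of the monomials in `z₁,z₂,z₃` of degree `d`. -/
noncomputable def Ssub (d : ℕ) : Submodule Z3loc Rring :=
  Submodule.span Z3loc {x | ∃ a b c : ℕ, a + b + c = d ∧
    x = zR 0 ^ a * zR 1 ^ b * zR 2 ^ c}

theorem S_le_F (d : ℕ) : Ssub d ≤ Fsub d := by
  refine Submodule.span_mono ?_
  rintro x ⟨a, b, c, h, rfl⟩
  exact ⟨a, b, c, 0, by omega, by simp⟩

theorem S_mul {m n k : ℕ} (h : m + n = k) {x y : Rring} (hx : x ∈ Ssub m) (hy : y ∈ Ssub n) :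
    x * y ∈ Ssub k := by
  have := Submodule.mul_mem_mul hx hy
  unfold Ssub at this
  rw [Submodule.span_mul_span] at this
  refine Submodule.span_mono ?_ this
  rintro _ ⟨_, ⟨a, b, c, h1, rfl⟩, _, ⟨a', b', c', h2, rfl⟩, rfl⟩
  exact ⟨a + a', b + b', c + c', by omega, by simp only [pow_add]; ring⟩

theorem F_mul {m n k : ℕ} (h : m + n = k) {x y : Rring} (hx : x ∈ Fsub m) (hy : y ∈ Fsub n) :
    x * y ∈ Fsub k := by
  have := Submodule.mul_mem_mul hx hy
  unfold Fsub at this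
  rw [Submodule.span_mul_span] at this
  refine Submodule.span_mono ?_ this
  rintro _ ⟨_, ⟨a, b, c, e, h1, rfl⟩, _, ⟨a', b', c', e', h2, rfl⟩, rfl⟩
  exact ⟨a + a', b + b', c + c', e + e', by omega, by simp only [pow_add]; ring⟩

theorem z0_S : zR 0 ∈ Ssub 1 := Submodule.subset_span ⟨1, 0, 0, rfl, by simp⟩
theorem z1_S : zR 1 ∈ Ssub 1 := Submodule.subset_span ⟨0, 1, 0, rfl, by simp⟩
theorem z2_S : zR 2 ∈ Ssub 1 := Submodule.subset_span ⟨0, 0, 1, rfl, by simp⟩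
theorem one_S : 1 ∈ Ssub 0 := Submodule.subset_span ⟨0, 0, 0, rfl, by simp⟩
theorem r_F : zR 3 ∈ Fsub 2 := Submodule.subset_span ⟨0, 0, 0, 1, rfl, by simp⟩
theorem one_F : 1 ∈ Fsub 0 := S_le_F 0 one_S
theorem σ_S : σ₁R ∈ Ssub 1 := add_mem (add_mem z0_S z1_S) z2_S

theorem S_pow {x : Rring} (hx : x ∈ Ssub 1) (n : ℕ) : x ^ n ∈ Ssub n := by
  induction n with
  | zero => simpa using one_S
  | succ n ih => rw [pow_succ]; exact S_mul rfl ih hx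

theorem int_mem (N : Submodule Z3loc Rring) (c : ℤ) {x : Rring} (hx : x ∈ N) :
    ((c : ℤ) : Rring) * x ∈ N := by
  rw [← zsmul_eq_mul]; exact zsmul_mem hx c

theorem mo_S (c : ℤ) (a b e n : ℕ) (h : a + b + e = n) :
    ((c : ℤ) : Rring) * (σ₁R ^ a * zR 1 ^ b * zR 2 ^ e) ∈ Ssub n :=
  int_mem _ _ (S_mul h (S_mul rfl (S_pow σ_S a) (S_pow z1_S b)) (S_pow z2_S e))

noncomputable def p2R : Rring := (zR 0 - zR 1 + zR 2) ^ 2 - 4 * (zR 1 * zR 2)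
noncomputable def p4R : Rring := zR 0 * zR 2 ^ 2 * (zR 0 - zR 1 + zR 2)

def degX : Fin 16 → ℕ := ![0, 1, 1, 1, 2, 2, 2, 2, 3, 3, 3, 3, 4, 4, 4, 5]

noncomputable def Lsub (n : ℕ) : Submodule Z3loc Rring :=
  Submodule.span Z3loc
    ({x | ∃ i, degX i = n ∧ x = Xfam i} ∪ {x | ∃ f ∈ Ssub n, x = 3 * f} ∪
      {x | ∃ e, e + 2 = n ∧ ∃ f ∈ Ssub e, x = p2R * f} ∪
      {x | ∃ e, e + 4 = n ∧ ∃ f ∈ Ssub e, x = p4R * f})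

theorem L_X (i : Fin 16) : Xfam i ∈ Lsub (degX i) :=
  Submodule.subset_span (Or.inl (Or.inl (Or.inl ⟨i, rfl, rfl⟩)))
theorem L_3 {n : ℕ} {f : Rring} (hf : f ∈ Ssub n) : 3 * f ∈ Lsub n :=
  Submodule.subset_span (Or.inl (Or.inl (Or.inr ⟨f, hf, rfl⟩)))
theorem L_p2 {n e : ℕ} (h : e + 2 = n) {f : Rring} (hf : f ∈ Ssub e) : p2R * f ∈ Lsub n :=
  Submodule.subset_span (Or.inl (Or.inr ⟨e, h, f, hf, rfl⟩))
theorem L_p4 {n e : ℕ} (h : e + 4 = n) {f : Rring} (hf : f ∈ Ssub e) : p4R * f ∈ Lsub n :=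
  Submodule.subset_span (Or.inr ⟨e, h, f, hf, rfl⟩)

theorem mX0 : 1 ∈ Lsub 0 := L_X 0
theorem mX1 : σ₁R ∈ Lsub 1 := L_X 1
theorem mX2 : zR 1 ∈ Lsub 1 := L_X 2
theorem mX3 : zR 2 ∈ Lsub 1 := L_X 3
theorem mX4 : σ₁R^2 ∈ Lsub 2 := L_X 4
theorem mX5 : σ₁R*zR 1 ∈ Lsub 2 := L_X 5
theorem mX6 : σ₁R*zR 2 ∈ Lsub 2 := L_X 6
theorem mX7 : zR 1*zR 2 ∈ Lsub 2 := L_X 7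
theorem mX8 : σ₁R^3 ∈ Lsub 3 := L_X 8
theorem mX9 : σ₁R^2*zR 1 ∈ Lsub 3 := L_X 9
theorem mX10 : σ₁R^2*zR 2 ∈ Lsub 3 := L_X 10
theorem mX11 : σ₃R ∈ Lsub 3 := L_X 11
theorem mX12 : σ₁R^4 ∈ Lsub 4 := L_X 12
theorem mX13 : σ₁R^3*zR 1 ∈ Lsub 4 := L_X 13
theorem mX14 : σ₁R^3*zR 2 ∈ Lsub 4 := L_X 14
theorem mX15 : σ₁R^4*zR 1 ∈ Lsub 5 := L_X 15

theorem cid_ss_vw {A : Type*} [CommRing A] (u v w s : A) (hs : s = u + v + w)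
    (hr : u*v + v*w + w*u = 0) :
    s*(v*w) = ((1:ℤ):A)*(s^2*v)
      + ((-1:ℤ):A)*(s^2*w)
      + 3*(((2:ℤ):A)*(s^1*v^1*w^1) + ((-1:ℤ):A)*(s^1*v^2*w^0) + ((1:ℤ):A)*(s^0*v^3*w^0) + ((-3:ℤ):A)*(s^0*v^2*w^1) + ((1:ℤ):A)*(s^0*v^1*w^2))
      + ((u-v+w)^2-4*(v*w))*(((-1:ℤ):A)*(s^0*v^1*w^0) + ((1:ℤ):A)*(s^0*v^0*w^1)) := by
  push_cast
  subst hs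
  linear_combination ((-1)*((u+v+w)^0*v^1*w^0)) * hr

theorem cert_ss_vw : σ₁R*(zR 1*zR 2) ∈ Lsub 3 := by
  have e : σ₁R*(zR 1*zR 2) = ((1:ℤ):Rring)*(σ₁R^2*zR 1)
      + ((-1:ℤ):Rring)*(σ₁R^2*zR 2)
      + 3*(((2:ℤ):Rring)*(σ₁R^1*zR 1^1*zR 2^1) + ((-1:ℤ):Rring)*(σ₁R^1*zR 1^2*zR 2^0) + ((1:ℤ):Rring)*(σ₁R^0*zR 1^3*zR 2^0) + ((-3:ℤ):Rring)*(σ₁R^0*zR 1^2*zR 2^1) + ((1:ℤ):Rring)*(σ₁R^0*zR 1^1*zR 2^2))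
      + p2R*(((-1:ℤ):Rring)*(σ₁R^0*zR 1^1*zR 2^0) + ((1:ℤ):Rring)*(σ₁R^0*zR 1^0*zR 2^1)) :=
    cid_ss_vw (zR 0) (zR 1) (zR 2) σ₁R rfl rel
  rw [e]
  exact add_mem (add_mem (add_mem (int_mem _ _ mX9) (int_mem _ _ mX10)) (L_3 (add_mem (add_mem (add_mem (add_mem (mo_S _ _ _ _ _ rfl) (mo_S _ _ _ _ _ rfl)) (mo_S _ _ _ _ _ rfl)) (mo_S _ _ _ _ _ rfl)) (mo_S _ _ _ _ _ rfl)))) (L_p2 (e := 1) rfl (add_mem (mo_S _ _ _ _ _ rfl) (mo_S _ _ _ _ _ rfl)))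

theorem cid_s_s3 {A : Type*} [CommRing A] (u v w s : A) (hs : s = u + v + w)
    (hr : u*v + v*w + w*u = 0) :
    s*(u*v*w) = ((-1:ℤ):A)*(s^4)
      + 3*(((1:ℤ):A)*(s^2*v^1*w^1) + ((3:ℤ):A)*(s^1*v^2*w^1) + ((1:ℤ):A)*(s^3*v^1*w^0) + ((-2:ℤ):A)*(s^1*v^3*w^0) + ((1:ℤ):A)*(s^0*v^4*w^0) + ((-3:ℤ):A)*(s^0*v^3*w^1) + ((1:ℤ):A)*(s^0*v^2*w^2))
      + ((u-v+w)^2-4*(v*w))*(((1:ℤ):A)*(s^2*v^0*w^0) + ((1:ℤ):A)*(s^1*v^1*w^0) + ((-1:ℤ):A)*(s^0*v^2*w^0) + ((1:ℤ):A)*(s^0*v^1*w^1)) := by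
  push_cast
  subst hs
  linear_combination ((1)*((u+v+w)^1*v^1*w^0) + (-1)*((u+v+w)^0*v^2*w^0)) * hr

theorem cert_s_s3 : σ₁R*σ₃R ∈ Lsub 4 := by
  have e : σ₁R*σ₃R = ((-1:ℤ):Rring)*(σ₁R^4)
      + 3*(((1:ℤ):Rring)*(σ₁R^2*zR 1^1*zR 2^1) + ((3:ℤ):Rring)*(σ₁R^1*zR 1^2*zR 2^1) + ((1:ℤ):Rring)*(σ₁R^3*zR 1^1*zR 2^0) + ((-2:ℤ):Rring)*(σ₁R^1*zR 1^3*zR 2^0) + ((1:ℤ):Rring)*(σ₁R^0*zR 1^4*zR 2^0) + ((-3:ℤ):Rring)*(σ₁R^0*zR 1^3*zR 2^1) + ((1:ℤ):Rring)*(σ₁R^0*zR 1^2*zR 2^2))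
      + p2R*(((1:ℤ):Rring)*(σ₁R^2*zR 1^0*zR 2^0) + ((1:ℤ):Rring)*(σ₁R^1*zR 1^1*zR 2^0) + ((-1:ℤ):Rring)*(σ₁R^0*zR 1^2*zR 2^0) + ((1:ℤ):Rring)*(σ₁R^0*zR 1^1*zR 2^1)) :=
    cid_s_s3 (zR 0) (zR 1) (zR 2) σ₁R rfl rel
  rw [e]
  exact add_mem (add_mem (int_mem _ _ mX12) (L_3 (add_mem (add_mem (add_mem (add_mem (add_mem (add_mem (mo_S _ _ _ _ _ rfl) (mo_S _ _ _ _ _ rfl)) (mo_S _ _ _ _ _ rfl)) (mo_S _ _ _ _ _ rfl)) (mo_S _ _ _ _ _ rfl)) (mo_S _ _ _ _ _ rfl)) (mo_S _ _ _ _ _ rfl)))) (L_p2 (e := 2) rfl (add_mem (add_mem (add_mem (mo_S _ _ _ _ _ rfl) (mo_S _ _ _ _ _ rfl)) (mo_S _ _ _ _ _ rfl)) (mo_S _ _ _ _ _ rfl)))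

theorem cid_s5 {A : Type*} [CommRing A] (u v w s : A) (hs : s = u + v + w)
    (hr : u*v + v*w + w*u = 0) :
    s^5 = 3*(((1:ℤ):A)*(s^4*v^1*w^0) + ((-1:ℤ):A)*(s^3*v^2*w^0) + ((2:ℤ):A)*(s^2*v^2*w^1) + ((1:ℤ):A)*(s^2*v^3*w^0) + ((-2:ℤ):A)*(s^1*v^4*w^0) + ((2:ℤ):A)*(s^1*v^1*w^3) + ((1:ℤ):A)*(s^0*v^5*w^0) + ((-3:ℤ):A)*(s^0*v^4*w^1) + ((2:ℤ):A)*(s^1*v^3*w^1) + ((1:ℤ):A)*(s^0*v^3*w^2) + ((-1:ℤ):A)*(s^2*v^1*w^2) + ((1:ℤ):A)*(s^1*v^2*w^2))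
      + ((u-v+w)^2-4*(v*w))*(((1:ℤ):A)*(s^3*v^0*w^0) + ((-1:ℤ):A)*(s^2*v^0*w^1) + ((1:ℤ):A)*(s^1*v^2*w^0) + ((1:ℤ):A)*(s^1*v^1*w^1) + ((1:ℤ):A)*(s^1*v^0*w^2) + ((-1:ℤ):A)*(s^0*v^3*w^0) + ((1:ℤ):A)*(s^0*v^2*w^1))
      + (u*w^2*(u-v+w))*(((-1:ℤ):A)*(s^1*v^0*w^0)) := by
  push_cast
  subst hs
  linear_combination ((1)*((u+v+w)^3*v^0*w^0) + (-1)*((u+v+w)^2*v^1*w^0) + (1)*((u+v+w)^2*v^0*w^1) + (1)*((u+v+w)^1*v^2*w^0) + (-1)*((u+v+w)^0*v^3*w^0)) * hr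

theorem cert_s5 : σ₁R^5 ∈ Lsub 5 := by
  have e : σ₁R^5 = 3*(((1:ℤ):Rring)*(σ₁R^4*zR 1^1*zR 2^0) + ((-1:ℤ):Rring)*(σ₁R^3*zR 1^2*zR 2^0) + ((2:ℤ):Rring)*(σ₁R^2*zR 1^2*zR 2^1) + ((1:ℤ):Rring)*(σ₁R^2*zR 1^3*zR 2^0) + ((-2:ℤ):Rring)*(σ₁R^1*zR 1^4*zR 2^0) + ((2:ℤ):Rring)*(σ₁R^1*zR 1^1*zR 2^3) + ((1:ℤ):Rring)*(σ₁R^0*zR 1^5*zR 2^0) + ((-3:ℤ):Rring)*(σ₁R^0*zR 1^4*zR 2^1) + ((2:ℤ):Rring)*(σ₁R^1*zR 1^3*zR 2^1) + ((1:ℤ):Rring)*(σ₁R^0*zR 1^3*zR 2^2) + ((-1:ℤ):Rring)*(σ₁R^2*zR 1^1*zR 2^2) + ((1:ℤ):Rring)*(σ₁R^1*zR 1^2*zR 2^2))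
      + p2R*(((1:ℤ):Rring)*(σ₁R^3*zR 1^0*zR 2^0) + ((-1:ℤ):Rring)*(σ₁R^2*zR 1^0*zR 2^1) + ((1:ℤ):Rring)*(σ₁R^1*zR 1^2*zR 2^0) + ((1:ℤ):Rring)*(σ₁R^1*zR 1^1*zR 2^1) + ((1:ℤ):Rring)*(σ₁R^1*zR 1^0*zR 2^2) + ((-1:ℤ):Rring)*(σ₁R^0*zR 1^3*zR 2^0) + ((1:ℤ):Rring)*(σ₁R^0*zR 1^2*zR 2^1))
      + p4R*(((-1:ℤ):Rring)*(σ₁R^1*zR 1^0*zR 2^0)) :=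
    cid_s5 (zR 0) (zR 1) (zR 2) σ₁R rfl rel
  rw [e]
  exact add_mem (add_mem (L_3 (add_mem (add_mem (add_mem (add_mem (add_mem (add_mem (add_mem (add_mem (add_mem (add_mem (add_mem (mo_S _ _ _ _ _ rfl) (mo_S _ _ _ _ _ rfl)) (mo_S _ _ _ _ _ rfl)) (mo_S _ _ _ _ _ rfl)) (mo_S _ _ _ _ _ rfl)) (mo_S _ _ _ _ _ rfl)) (mo_S _ _ _ _ _ rfl)) (mo_S _ _ _ _ _ rfl)) (mo_S _ _ _ _ _ rfl)) (mo_S _ _ _ _ _ rfl)) (mo_S _ _ _ _ _ rfl)) (mo_S _ _ _ _ _ rfl))) (L_p2 (e := 3) rfl (add_mem (add_mem (add_mem (add_mem (add_mem (add_mem (mo_S _ _ _ _ _ rfl) (mo_S _ _ _ _ _ rfl)) (mo_S _ _ _ _ _ rfl)) (mo_S _ _ _ _ _ rfl)) (mo_S _ _ _ _ _ rfl)) (mo_S _ _ _ _ _ rfl)) (mo_S _ _ _ _ _ rfl)))) (L_p4 (e := 1) rfl (mo_S _ _ _ _ _ rfl))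

theorem cid_s4w {A : Type*} [CommRing A] (u v w s : A) (hs : s = u + v + w)
    (hr : u*v + v*w + w*u = 0) :
    s^4*w = ((1:ℤ):A)*(s^4*v)
      + 3*(((-1:ℤ):A)*(s^4*v^1*w^0) + ((2:ℤ):A)*(s^3*v^2*w^0) + ((-2:ℤ):A)*(s^2*v^3*w^0) + ((3:ℤ):A)*(s^2*v^2*w^1) + ((-3:ℤ):A)*(s^1*v^3*w^1) + ((4:ℤ):A)*(s^1*v^2*w^2) + ((1:ℤ):A)*(s^1*v^4*w^0) + ((-1:ℤ):A)*(s^0*v^5*w^0) + ((3:ℤ):A)*(s^0*v^4*w^1) + ((-3:ℤ):A)*(s^0*v^3*w^2) + ((-1:ℤ):A)*(s^2*v^1*w^2) + ((1:ℤ):A)*(s^1*v^1*w^3) + ((2:ℤ):A)*(s^0*v^1*w^4))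
      + ((u-v+w)^2-4*(v*w))*(((1:ℤ):A)*(s^2*v^1*w^0) + ((1:ℤ):A)*(s^1*v^1*w^1) + ((1:ℤ):A)*(s^0*v^3*w^0) + ((-1:ℤ):A)*(s^0*v^2*w^1) + ((1:ℤ):A)*(s^0*v^1*w^2) + ((1:ℤ):A)*(s^0*v^0*w^3))
      + (u*w^2*(u-v+w))*(((1:ℤ):A)*(s^0*v^1*w^0) + ((-1:ℤ):A)*(s^0*v^0*w^1)) := by
  push_cast
  subst hs
  linear_combination ((1)*((u+v+w)^3*v^0*w^0) + (-1)*((u+v+w)^2*v^1*w^0) + (1)*((u+v+w)^2*v^0*w^1) + (1)*((u+v+w)^1*v^0*w^2) + (1)*((u+v+w)^0*v^3*w^0)) * hr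

theorem cert_s4w : σ₁R^4*zR 2 ∈ Lsub 5 := by
  have e : σ₁R^4*zR 2 = ((1:ℤ):Rring)*(σ₁R^4*zR 1)
      + 3*(((-1:ℤ):Rring)*(σ₁R^4*zR 1^1*zR 2^0) + ((2:ℤ):Rring)*(σ₁R^3*zR 1^2*zR 2^0) + ((-2:ℤ):Rring)*(σ₁R^2*zR 1^3*zR 2^0) + ((3:ℤ):Rring)*(σ₁R^2*zR 1^2*zR 2^1) + ((-3:ℤ):Rring)*(σ₁R^1*zR 1^3*zR 2^1) + ((4:ℤ):Rring)*(σ₁R^1*zR 1^2*zR 2^2) + ((1:ℤ):Rring)*(σ₁R^1*zR 1^4*zR 2^0) + ((-1:ℤ):Rring)*(σ₁R^0*zR 1^5*zR 2^0) + ((3:ℤ):Rring)*(σ₁R^0*zR 1^4*zR 2^1) + ((-3:ℤ):Rring)*(σ₁R^0*zR 1^3*zR 2^2) + ((-1:ℤ):Rring)*(σ₁R^2*zR 1^1*zR 2^2) + ((1:ℤ):Rring)*(σ₁R^1*zR 1^1*zR 2^3) + ((2:ℤ):Rring)*(σ₁R^0*zR 1^1*zR 2^4))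
      + p2R*(((1:ℤ):Rring)*(σ₁R^2*zR 1^1*zR 2^0) + ((1:ℤ):Rring)*(σ₁R^1*zR 1^1*zR 2^1) + ((1:ℤ):Rring)*(σ₁R^0*zR 1^3*zR 2^0) + ((-1:ℤ):Rring)*(σ₁R^0*zR 1^2*zR 2^1) + ((1:ℤ):Rring)*(σ₁R^0*zR 1^1*zR 2^2) + ((1:ℤ):Rring)*(σ₁R^0*zR 1^0*zR 2^3))
      + p4R*(((1:ℤ):Rring)*(σ₁R^0*zR 1^1*zR 2^0) + ((-1:ℤ):Rring)*(σ₁R^0*zR 1^0*zR 2^1)) :=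
    cid_s4w (zR 0) (zR 1) (zR 2) σ₁R rfl rel
  rw [e]
  exact add_mem (add_mem (add_mem (int_mem _ _ mX15) (L_3 (add_mem (add_mem (add_mem (add_mem (add_mem (add_mem (add_mem (add_mem (add_mem (add_mem (add_mem (add_mem (mo_S _ _ _ _ _ rfl) (mo_S _ _ _ _ _ rfl)) (mo_S _ _ _ _ _ rfl)) (mo_S _ _ _ _ _ rfl)) (mo_S _ _ _ _ _ rfl)) (mo_S _ _ _ _ _ rfl)) (mo_S _ _ _ _ _ rfl)) (mo_S _ _ _ _ _ rfl)) (mo_S _ _ _ _ _ rfl)) (mo_S _ _ _ _ _ rfl)) (mo_S _ _ _ _ _ rfl)) (mo_S _ _ _ _ _ rfl)) (mo_S _ _ _ _ _ rfl)))) (L_p2 (e := 3) rfl (add_mem (add_mem (add_mem (add_mem (add_mem (mo_S _ _ _ _ _ rfl) (mo_S _ _ _ _ _ rfl)) (mo_S _ _ _ _ _ rfl)) (mo_S _ _ _ _ _ rfl)) (mo_S _ _ _ _ _ rfl)) (mo_S _ _ _ _ _ rfl)))) (L_p4 (e := 1) rfl (add_mem (mo_S _ _ _ _ _ rfl) (mo_S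 _ _ _ _ _ rfl)))

theorem cid_s5v {A : Type*} [CommRing A] (u v w s : A) (hs : s = u + v + w)
    (hr : u*v + v*w + w*u = 0) :
    s^5*v = 3*(((-1:ℤ):A)*(s^4*v^1*w^1) + ((-1:ℤ):A)*(s^3*v^1*w^2) + ((1:ℤ):A)*(s^3*v^3*w^0) + ((-1:ℤ):A)*(s^2*v^4*w^0) + ((3:ℤ):A)*(s^2*v^3*w^1) + ((-3:ℤ):A)*(s^2*v^1*w^3) + ((-1:ℤ):A)*(s^2*v^2*w^2) + ((2:ℤ):A)*(s^0*v^4*w^2) + ((-2:ℤ):A)*(s^0*v^3*w^3) + ((2:ℤ):A)*(s^0*v^2*w^4) + ((-2:ℤ):A)*(s^0*v^1*w^5) + ((1:ℤ):A)*(s^3*v^0*w^3) + ((-1:ℤ):A)*(s^1*v^3*w^2))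
      + ((u-v+w)^2-4*(v*w))*(((-1:ℤ):A)*(s^3*v^0*w^1) + ((1:ℤ):A)*(s^2*v^2*w^0) + ((-1:ℤ):A)*(s^2*v^1*w^1) + ((-1:ℤ):A)*(s^2*v^0*w^2) + ((-1:ℤ):A)*(s^1*v^1*w^2) + ((-1:ℤ):A)*(s^0*v^2*w^2) + ((1:ℤ):A)*(s^0*v^1*w^3) + ((-1:ℤ):A)*(s^0*v^0*w^4))
      + (u*w^2*(u-v+w))*(((1:ℤ):A)*(s^2*v^0*w^0) + ((-1:ℤ):A)*(s^1*v^0*w^1) + ((-1:ℤ):A)*(s^0*v^2*w^0) + ((1:ℤ):A)*(s^0*v^0*w^2)) := by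
  push_cast
  subst hs
  linear_combination ((1)*((u+v+w)^4*v^0*w^0) + (1)*((u+v+w)^3*v^0*w^1) + (1)*((u+v+w)^2*v^2*w^0) + (-1)*((u+v+w)^1*v^0*w^3)) * hr

theorem cert_s5v : σ₁R^5*zR 1 ∈ Lsub 6 := by
  have e : σ₁R^5*zR 1 = 3*(((-1:ℤ):Rring)*(σ₁R^4*zR 1^1*zR 2^1) + ((-1:ℤ):Rring)*(σ₁R^3*zR 1^1*zR 2^2) + ((1:ℤ):Rring)*(σ₁R^3*zR 1^3*zR 2^0) + ((-1:ℤ):Rring)*(σ₁R^2*zR 1^4*zR 2^0) + ((3:ℤ):Rring)*(σ₁R^2*zR 1^3*zR 2^1) + ((-3:ℤ):Rring)*(σ₁R^2*zR 1^1*zR 2^3) + ((-1:ℤ):Rring)*(σ₁R^2*zR 1^2*zR 2^2) + ((2:ℤ):Rring)*(σ₁R^0*zR 1^4*zR 2^2) + ((-2:ℤ):Rring)*(σ₁R^0*zR 1^3*zR 2^3) + ((2:ℤ):Rring)*(σ₁R^0*zR 1^2*zR 2^4) + ((-2:ℤ):Rring)*(σ₁R^0*zR 1^1*zR 2^5) +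 ((1:ℤ):Rring)*(σ₁R^3*zR 1^0*zR 2^3) + ((-1:ℤ):Rring)*(σ₁R^1*zR 1^3*zR 2^2))
      + p2R*(((-1:ℤ):Rring)*(σ₁R^3*zR 1^0*zR 2^1) + ((1:ℤ):Rring)*(σ₁R^2*zR 1^2*zR 2^0) + ((-1:ℤ):Rring)*(σ₁R^2*zR 1^1*zR 2^1) + ((-1:ℤ):Rring)*(σ₁R^2*zR 1^0*zR 2^2) + ((-1:ℤ):Rring)*(σ₁R^1*zR 1^1*zR 2^2) + ((-1:ℤ):Rring)*(σ₁R^0*zR 1^2*zR 2^2) + ((1:ℤ):Rring)*(σ₁R^0*zR 1^1*zR 2^3) + ((-1:ℤ):Rring)*(σ₁R^0*zR 1^0*zR 2^4))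
      + p4R*(((1:ℤ):Rring)*(σ₁R^2*zR 1^0*zR 2^0) + ((-1:ℤ):Rring)*(σ₁R^1*zR 1^0*zR 2^1) + ((-1:ℤ):Rring)*(σ₁R^0*zR 1^2*zR 2^0) + ((1:ℤ):Rring)*(σ₁R^0*zR 1^0*zR 2^2)) :=
    cid_s5v (zR 0) (zR 1) (zR 2) σ₁R rfl rel
  rw [e]
  exact add_mem (add_mem (L_3 (add_mem (add_mem (add_mem (add_mem (add_mem (add_mem (add_mem (add_mem (add_mem (add_mem (add_mem (add_mem (mo_S _ _ _ _ _ rfl) (mo_S _ _ _ _ _ rfl)) (mo_S _ _ _ _ _ rfl)) (mo_S _ _ _ _ _ rfl)) (mo_S _ _ _ _ _ rfl)) (mo_S _ _ _ _ _ rfl)) (mo_S _ _ _ _ _ rfl)) (mo_S _ _ _ _ _ rfl)) (mo_S _ _ _ _ _ rfl)) (mo_S _ _ _ _ _ rfl)) (mo_S _ _ _ _ _ rfl)) (mo_S _ _ _ _ _ rfl)) (mo_S _ _ _ _ _ rfl))) (L_p2 (e := 4) rfl (add_mem (add_mem (add_mem (add_mem (add_mem (add_mem (add_mem (mo_S _ _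 _ _ _ rfl) (mo_S _ _ _ _ _ rfl)) (mo_S _ _ _ _ _ rfl)) (mo_S _ _ _ _ _ rfl)) (mo_S _ _ _ _ _ rfl)) (mo_S _ _ _ _ _ rfl)) (mo_S _ _ _ _ _ rfl)) (mo_S _ _ _ _ _ rfl)))) (L_p4 (e := 2) rfl (add_mem (add_mem (add_mem (mo_S _ _ _ _ _ rfl) (mo_S _ _ _ _ _ rfl)) (mo_S _ _ _ _ _ rfl)) (mo_S _ _ _ _ _ rfl)))

theorem cid_vv {A : Type*} [CommRing A] (u v w s : A) (hs : s = u + v + w)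
    (hr : u*v + v*w + w*u = 0) :
    v*v = ((-1:ℤ):A)*(s^2)
      + ((1:ℤ):A)*(s*v)
      + ((1:ℤ):A)*(v*w)
      + 3*(((-1:ℤ):A)*(s^0*v^2*w^0) + ((1:ℤ):A)*(s^1*v^1*w^0) + ((1:ℤ):A)*(s^0*v^1*w^1))
      + ((u-v+w)^2-4*(v*w))*(((1:ℤ):A)*(s^0*v^0*w^0)) := by
  push_cast
  subst hs
  linear_combination (0) * hr

theorem cert_vv : zR 1*zR 1 ∈ Lsub 2 := by
  have e : zR 1*zR 1 = ((-1:ℤ):Rring)*(σ₁R^2)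
      + ((1:ℤ):Rring)*(σ₁R*zR 1)
      + ((1:ℤ):Rring)*(zR 1*zR 2)
      + 3*(((-1:ℤ):Rring)*(σ₁R^0*zR 1^2*zR 2^0) + ((1:ℤ):Rring)*(σ₁R^1*zR 1^1*zR 2^0) + ((1:ℤ):Rring)*(σ₁R^0*zR 1^1*zR 2^1))
      + p2R*(((1:ℤ):Rring)*(σ₁R^0*zR 1^0*zR 2^0)) :=
    cid_vv (zR 0) (zR 1) (zR 2) σ₁R rfl rel
  rw [e]
  exact add_mem (add_mem (add_mem (add_mem (int_mem _ _ mX4) (int_mem _ _ mX5)) (int_mem _ _ mX7)) (L_3 (add_mem (add_mem (mo_S _ _ _ _ _ rfl) (mo_S _ _ _ _ _ rfl)) (mo_S _ _ _ _ _ rfl)))) (L_p2 (e := 0) rfl (mo_S _ _ _ _ _ rfl))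

theorem cid_vvw {A : Type*} [CommRing A] (u v w s : A) (hs : s = u + v + w)
    (hr : u*v + v*w + w*u = 0) :
    v*(v*w) = ((1:ℤ):A)*(s^2*v)
      + ((1:ℤ):A)*((u*v*w))
      + 3*(((-1:ℤ):A)*(s^0*v^2*w^1) + ((-1:ℤ):A)*(s^1*v^2*w^0) + ((1:ℤ):A)*(s^0*v^3*w^0))
      + ((u-v+w)^2-4*(v*w))*(((-1:ℤ):A)*(s^0*v^1*w^0)) := by
  push_cast
  subst hs
  linear_combination ((-1)*((u+v+w)^0*v^1*w^0)) * hr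

theorem cert_vvw : zR 1*(zR 1*zR 2) ∈ Lsub 3 := by
  have e : zR 1*(zR 1*zR 2) = ((1:ℤ):Rring)*(σ₁R^2*zR 1)
      + ((1:ℤ):Rring)*(σ₃R)
      + 3*(((-1:ℤ):Rring)*(σ₁R^0*zR 1^2*zR 2^1) + ((-1:ℤ):Rring)*(σ₁R^1*zR 1^2*zR 2^0) + ((1:ℤ):Rring)*(σ₁R^0*zR 1^3*zR 2^0))
      + p2R*(((-1:ℤ):Rring)*(σ₁R^0*zR 1^1*zR 2^0)) :=
    cid_vvw (zR 0) (zR 1) (zR 2) σ₁R rfl rel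
  rw [e]
  exact add_mem (add_mem (add_mem (int_mem _ _ mX9) (int_mem _ _ mX11)) (L_3 (add_mem (add_mem (mo_S _ _ _ _ _ rfl) (mo_S _ _ _ _ _ rfl)) (mo_S _ _ _ _ _ rfl)))) (L_p2 (e := 1) rfl (mo_S _ _ _ _ _ rfl))

theorem cid_v_s3 {A : Type*} [CommRing A] (u v w s : A) (hs : s = u + v + w)
    (hr : u*v + v*w + w*u = 0) :
    v*(u*v*w) = ((1:ℤ):A)*(s^4)
      + ((-1:ℤ):A)*(s^3*v)
      + 3*(((-1:ℤ):A)*(s^1*v^2*w^1) + ((1:ℤ):A)*(s^0*v^3*w^1) + ((-1:ℤ):A)*(s^0*v^2*w^2) + ((-1:ℤ):A)*(s^3*v^1*w^0) + ((2:ℤ):A)*(s^2*v^2*w^0) + ((-1:ℤ):A)*(s^1*v^3*w^0) + ((-2:ℤ):A)*(s^0*v^1*w^3) + ((1:ℤ):A)*(s^1*v^1*w^2))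
      + ((u-v+w)^2-4*(v*w))*(((-1:ℤ):A)*(s^2*v^0*w^0) + ((1:ℤ):A)*(s^1*v^1*w^0) + ((1:ℤ):A)*(s^1*v^0*w^1) + ((-1:ℤ):A)*(s^0*v^1*w^1) + ((-1:ℤ):A)*(s^0*v^0*w^2))
      + (u*w^2*(u-v+w))*(((1:ℤ):A)*(s^0*v^0*w^0)) := by
  push_cast
  subst hs
  linear_combination ((-1)*((u+v+w)^2*v^0*w^0) + (1)*((u+v+w)^1*v^1*w^0) + (-1)*((u+v+w)^1*v^0*w^1)) * hr

theorem cert_v_s3 : zR 1*σ₃R ∈ Lsub 4 := by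
  have e : zR 1*σ₃R = ((1:ℤ):Rring)*(σ₁R^4)
      + ((-1:ℤ):Rring)*(σ₁R^3*zR 1)
      + 3*(((-1:ℤ):Rring)*(σ₁R^1*zR 1^2*zR 2^1) + ((1:ℤ):Rring)*(σ₁R^0*zR 1^3*zR 2^1) + ((-1:ℤ):Rring)*(σ₁R^0*zR 1^2*zR 2^2) + ((-1:ℤ):Rring)*(σ₁R^3*zR 1^1*zR 2^0) + ((2:ℤ):Rring)*(σ₁R^2*zR 1^2*zR 2^0) + ((-1:ℤ):Rring)*(σ₁R^1*zR 1^3*zR 2^0) + ((-2:ℤ):Rring)*(σ₁R^0*zR 1^1*zR 2^3) + ((1:ℤ):Rring)*(σ₁R^1*zR 1^1*zR 2^2))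
      + p2R*(((-1:ℤ):Rring)*(σ₁R^2*zR 1^0*zR 2^0) + ((1:ℤ):Rring)*(σ₁R^1*zR 1^1*zR 2^0) + ((1:ℤ):Rring)*(σ₁R^1*zR 1^0*zR 2^1) + ((-1:ℤ):Rring)*(σ₁R^0*zR 1^1*zR 2^1) + ((-1:ℤ):Rring)*(σ₁R^0*zR 1^0*zR 2^2))
      + p4R*(((1:ℤ):Rring)*(σ₁R^0*zR 1^0*zR 2^0)) :=
    cid_v_s3 (zR 0) (zR 1) (zR 2) σ₁R rfl rel
  rw [e]
  exact add_mem (add_mem (add_mem (add_mem (int_mem _ _ mX12) (int_mem _ _ mX13)) (L_3 (add_mem (add_mem (add_mem (add_mem (add_mem (add_mem (add_mem (mo_S _ _ _ _ _ rfl) (mo_S _ _ _ _ _ rfl)) (mo_S _ _ _ _ _ rfl)) (mo_S _ _ _ _ _ rfl)) (mo_S _ _ _ _ _ rfl)) (mo_S _ _ _ _ _ rfl)) (mo_S _ _ _ _ _ rfl)) (mo_S _ _ _ _ _ rfl)))) (L_p2 (e := 2) rfl (add_mem (add_mem (add_mem (add_mem (mo_S _ _ _ _ _ rfl) (mo_S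 _ _ _ _ _ rfl)) (mo_S _ _ _ _ _ rfl)) (mo_S _ _ _ _ _ rfl)) (mo_S _ _ _ _ _ rfl)))) (L_p4 (e := 0) rfl (mo_S _ _ _ _ _ rfl))

theorem cid_ww {A : Type*} [CommRing A] (u v w s : A) (hs : s = u + v + w)
    (hr : u*v + v*w + w*u = 0) :
    w*w = ((1:ℤ):A)*(s^2)
      + ((1:ℤ):A)*(s*w)
      + ((1:ℤ):A)*(v*w)
      + 3*(((-2:ℤ):A)*(s^0*v^1*w^1) + ((-1:ℤ):A)*(s^1*v^1*w^0) + ((1:ℤ):A)*(s^0*v^2*w^0))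
      + ((u-v+w)^2-4*(v*w))*(((-1:ℤ):A)*(s^0*v^0*w^0)) := by
  push_cast
  subst hs
  linear_combination ((-1)*((u+v+w)^0*v^0*w^0)) * hr

theorem cert_ww : zR 2*zR 2 ∈ Lsub 2 := by
  have e : zR 2*zR 2 = ((1:ℤ):Rring)*(σ₁R^2)
      + ((1:ℤ):Rring)*(σ₁R*zR 2)
      + ((1:ℤ):Rring)*(zR 1*zR 2)
      + 3*(((-2:ℤ):Rring)*(σ₁R^0*zR 1^1*zR 2^1) + ((-1:ℤ):Rring)*(σ₁R^1*zR 1^1*zR 2^0) + ((1:ℤ):Rring)*(σ₁R^0*zR 1^2*zR 2^0))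
      + p2R*(((-1:ℤ):Rring)*(σ₁R^0*zR 1^0*zR 2^0)) :=
    cid_ww (zR 0) (zR 1) (zR 2) σ₁R rfl rel
  rw [e]
  exact add_mem (add_mem (add_mem (add_mem (int_mem _ _ mX4) (int_mem _ _ mX6)) (int_mem _ _ mX7)) (L_3 (add_mem (add_mem (mo_S _ _ _ _ _ rfl) (mo_S _ _ _ _ _ rfl)) (mo_S _ _ _ _ _ rfl)))) (L_p2 (e := 0) rfl (mo_S _ _ _ _ _ rfl))

theorem cid_wvw {A : Type*} [CommRing A] (u v w s : A) (hs : s = u + v + w)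
    (hr : u*v + v*w + w*u = 0) :
    w*(v*w) = ((-1:ℤ):A)*(s^2*w)
      + ((1:ℤ):A)*((u*v*w))
      + 3*(((2:ℤ):A)*(s^0*v^1*w^2) + ((1:ℤ):A)*(s^1*v^1*w^1) + ((-1:ℤ):A)*(s^0*v^2*w^1))
      + ((u-v+w)^2-4*(v*w))*(((1:ℤ):A)*(s^0*v^0*w^1)) := by
  push_cast
  subst hs
  linear_combination (0) * hr

theorem cert_wvw : zR 2*(zR 1*zR 2) ∈ Lsub 3 := by
  have e : zR 2*(zR 1*zR 2) = ((-1:ℤ):Rring)*(σ₁R^2*zR 2)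
      + ((1:ℤ):Rring)*(σ₃R)
      + 3*(((2:ℤ):Rring)*(σ₁R^0*zR 1^1*zR 2^2) + ((1:ℤ):Rring)*(σ₁R^1*zR 1^1*zR 2^1) + ((-1:ℤ):Rring)*(σ₁R^0*zR 1^2*zR 2^1))
      + p2R*(((1:ℤ):Rring)*(σ₁R^0*zR 1^0*zR 2^1)) :=
    cid_wvw (zR 0) (zR 1) (zR 2) σ₁R rfl rel
  rw [e]
  exact add_mem (add_mem (add_mem (int_mem _ _ mX10) (int_mem _ _ mX11)) (L_3 (add_mem (add_mem (mo_S _ _ _ _ _ rfl) (mo_S _ _ _ _ _ rfl)) (mo_S _ _ _ _ _ rfl)))) (L_p2 (e := 1) rfl (mo_S _ _ _ _ _ rfl))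

theorem cid_w_s3 {A : Type*} [CommRing A] (u v w s : A) (hs : s = u + v + w)
    (hr : u*v + v*w + w*u = 0) :
    w*(u*v*w) = ((1:ℤ):A)*(s^4)
      + ((-1:ℤ):A)*(s^3*w)
      + 3*(((2:ℤ):A)*(s^1*v^1*w^2) + ((-2:ℤ):A)*(s^0*v^2*w^2) + ((-1:ℤ):A)*(s^0*v^1*w^3) + ((-1:ℤ):A)*(s^3*v^1*w^0) + ((2:ℤ):A)*(s^1*v^3*w^0) + ((-5:ℤ):A)*(s^1*v^2*w^1) + ((-1:ℤ):A)*(s^0*v^4*w^0) + ((3:ℤ):A)*(s^0*v^3*w^1) + ((1:ℤ):A)*(s^2*v^1*w^1))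
      + ((u-v+w)^2-4*(v*w))*(((-1:ℤ):A)*(s^2*v^0*w^0) + ((-1:ℤ):A)*(s^1*v^1*w^0) + ((1:ℤ):A)*(s^1*v^0*w^1) + ((1:ℤ):A)*(s^0*v^2*w^0) + ((-1:ℤ):A)*(s^0*v^1*w^1))
      + (u*w^2*(u-v+w))*(((1:ℤ):A)*(s^0*v^0*w^0)) := by
  push_cast
  subst hs
  linear_combination ((-1)*((u+v+w)^1*v^1*w^0) + (-1)*((u+v+w)^1*v^0*w^1) + (1)*((u+v+w)^0*v^2*w^0)) * hr

theorem cert_w_s3 : zR 2*σ₃R ∈ Lsub 4 := by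
  have e : zR 2*σ₃R = ((1:ℤ):Rring)*(σ₁R^4)
      + ((-1:ℤ):Rring)*(σ₁R^3*zR 2)
      + 3*(((2:ℤ):Rring)*(σ₁R^1*zR 1^1*zR 2^2) + ((-2:ℤ):Rring)*(σ₁R^0*zR 1^2*zR 2^2) + ((-1:ℤ):Rring)*(σ₁R^0*zR 1^1*zR 2^3) + ((-1:ℤ):Rring)*(σ₁R^3*zR 1^1*zR 2^0) + ((2:ℤ):Rring)*(σ₁R^1*zR 1^3*zR 2^0) + ((-5:ℤ):Rring)*(σ₁R^1*zR 1^2*zR 2^1) + ((-1:ℤ):Rring)*(σ₁R^0*zR 1^4*zR 2^0) + ((3:ℤ):Rring)*(σ₁R^0*zR 1^3*zR 2^1) + ((1:ℤ):Rring)*(σ₁R^2*zR 1^1*zR 2^1))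
      + p2R*(((-1:ℤ):Rring)*(σ₁R^2*zR 1^0*zR 2^0) + ((-1:ℤ):Rring)*(σ₁R^1*zR 1^1*zR 2^0) + ((1:ℤ):Rring)*(σ₁R^1*zR 1^0*zR 2^1) + ((1:ℤ):Rring)*(σ₁R^0*zR 1^2*zR 2^0) + ((-1:ℤ):Rring)*(σ₁R^0*zR 1^1*zR 2^1))
      + p4R*(((1:ℤ):Rring)*(σ₁R^0*zR 1^0*zR 2^0)) :=
    cid_w_s3 (zR 0) (zR 1) (zR 2) σ₁R rfl rel
  rw [e]
  exact add_mem (add_mem (add_mem (add_mem (int_mem _ _ mX12) (int_mem _ _ mX14)) (L_3 (add_mem (add_mem (add_mem (add_mem (add_mem (add_mem (add_mem (add_mem (mo_S _ _ _ _ _ rfl) (mo_S _ _ _ _ _ rfl)) (mo_S _ _ _ _ _ rfl)) (mo_S _ _ _ _ _ rfl)) (mo_S _ _ _ _ _ rfl)) (mo_S _ _ _ _ _ rfl)) (mo_S _ _ _ _ _ rfl)) (mo_S _ _ _ _ _ rfl)) (mo_S _ _ _ _ _ rfl)))) (L_p2 (e := 2) rfl (add_mem (add_mem (add_mem (add_mem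 (mo_S _ _ _ _ _ rfl) (mo_S _ _ _ _ _ rfl)) (mo_S _ _ _ _ _ rfl)) (mo_S _ _ _ _ _ rfl)) (mo_S _ _ _ _ _ rfl)))) (L_p4 (e := 0) rfl (mo_S _ _ _ _ _ rfl))

theorem mul_L_aux {z : Rring} (hz : z ∈ Ssub 1)
    (h : ∀ i, z * Xfam i ∈ Lsub (degX i + 1)) {n : ℕ} {x : Rring} (hx : x ∈ Lsub n) :
    z * x ∈ Lsub (n + 1) := by
  unfold Lsub at hx
  induction hx using Submodule.span_induction with
  | mem x hx =>
    rcases hx with ((⟨i, rfl, rfl⟩ | ⟨f, hf, rfl⟩) | ⟨e, rfl, f, hf, rfl⟩) | ⟨e, rfl, f, hf, rfl⟩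
    · exact h i
    · rw [mul_left_comm]; exact L_3 (S_mul (by omega) hz hf)
    · rw [mul_left_comm]; exact L_p2 (e := e + 1) (by omega) (S_mul (by omega) hz hf)
    · rw [mul_left_comm]; exact L_p4 (e := e + 1) (by omega) (S_mul (by omega) hz hf)
  | zero => rw [mul_zero]; exact zero_mem _
  | add x y _ _ hx hy => rw [mul_add]; exact add_mem hx hy
  | smul c x _ hx => rw [mul_smul_comm]; exact Submodule.smul_mem _ _ hx

theorem L_cast {n : ℕ} {x y : Rring} (h : x ∈ Lsub n) (e : y = x) : y ∈ Lsub n := e ▸ h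

theorem σ_L {n : ℕ} {x : Rring} (hx : x ∈ Lsub n) : σ₁R * x ∈ Lsub (n + 1) := by
  refine mul_L_aux σ_S ?_ hx
  intro i
  fin_cases i
  · exact L_cast mX1 (mul_one _)
  · exact L_cast mX4 (sq _).symm
  · exact mX5
  · exact mX6
  · exact L_cast mX8 (pow_succ' _ 2).symm
  · exact L_cast mX9 (show σ₁R * (σ₁R * zR 1) = _ by ring)
  · exact L_cast mX10 (show σ₁R * (σ₁R * zR 2) = _ by ring)
  · exact cert_ss_vw
  · exact L_cast mX12 (show σ₁R * σ₁R ^ 3 = _ by ring)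
  · exact L_cast mX13 (show σ₁R * (σ₁R ^ 2 * zR 1) = _ by ring)
  · exact L_cast mX14 (show σ₁R * (σ₁R ^ 2 * zR 2) = _ by ring)
  · exact cert_s_s3
  · exact L_cast cert_s5 (show σ₁R * σ₁R ^ 4 = _ by ring)
  · exact L_cast mX15 (show σ₁R * (σ₁R ^ 3 * zR 1) = _ by ring)
  · exact L_cast cert_s4w (show σ₁R * (σ₁R ^ 3 * zR 2) = _ by ring)
  · exact L_cast cert_s5v (show σ₁R * (σ₁R ^ 4 * zR 1) = _ by ring)

theorem z1_L {n : ℕ} {x : Rring} (hx : x ∈ Lsub n) : zR 1 * x ∈ Lsub (n + 1) := by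
  refine mul_L_aux z1_S ?_ hx
  intro i
  fin_cases i
  · exact L_cast mX2 (mul_one _)
  · exact L_cast mX5 (mul_comm _ _)
  · exact cert_vv
  · exact mX7
  · exact L_cast mX9 (mul_comm _ _)
  · exact L_cast (σ_L cert_vv) (show zR 1 * (σ₁R * zR 1) = _ by ring)
  · exact L_cast (σ_L mX7) (show zR 1 * (σ₁R * zR 2) = _ by ring)
  · exact cert_vvw
  · exact L_cast mX13 (mul_comm _ _)
  · exact L_cast (σ_L (σ_L cert_vv)) (show zR 1 * (σ₁R ^ 2 * zR 1) = _ by ring)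
  · exact L_cast (σ_L (σ_L mX7)) (show zR 1 * (σ₁R ^ 2 * zR 2) = _ by ring)
  · exact cert_v_s3
  · exact L_cast mX15 (mul_comm _ _)
  · exact L_cast (σ_L (σ_L (σ_L cert_vv))) (show zR 1 * (σ₁R ^ 3 * zR 1) = _ by ring)
  · exact L_cast (σ_L (σ_L (σ_L mX7))) (show zR 1 * (σ₁R ^ 3 * zR 2) = _ by ring)
  · exact L_cast (σ_L (σ_L (σ_L (σ_L cert_vv)))) (show zR 1 * (σ₁R ^ 4 * zR 1) = _ by ring)

theorem z2_L {n : ℕ} {x : Rring} (hx : x ∈ Lsub n) : zR 2 * x ∈ Lsub (n + 1) := by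
  refine mul_L_aux z2_S ?_ hx
  intro i
  fin_cases i
  · exact L_cast mX3 (mul_one _)
  · exact L_cast mX6 (mul_comm _ _)
  · exact L_cast mX7 (mul_comm _ _)
  · exact cert_ww
  · exact L_cast mX10 (mul_comm _ _)
  · exact L_cast (σ_L mX7) (show zR 2 * (σ₁R * zR 1) = _ by ring)
  · exact L_cast (σ_L cert_ww) (show zR 2 * (σ₁R * zR 2) = _ by ring)
  · exact cert_wvw
  · exact L_cast mX14 (mul_comm _ _)
  · exact L_cast (σ_L (σ_L mX7)) (show zR 2 * (σ₁R ^ 2 * zR 1) = _ by ring)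
  · exact L_cast (σ_L (σ_L cert_ww)) (show zR 2 * (σ₁R ^ 2 * zR 2) = _ by ring)
  · exact cert_w_s3
  · exact L_cast (σ_L mX14) (show zR 2 * σ₁R ^ 4 = _ by ring)
  · exact L_cast (σ_L (σ_L (σ_L mX7))) (show zR 2 * (σ₁R ^ 3 * zR 1) = _ by ring)
  · exact L_cast (σ_L (σ_L (σ_L cert_ww))) (show zR 2 * (σ₁R ^ 3 * zR 2) = _ by ring)
  · exact L_cast (σ_L (σ_L (σ_L (σ_L mX7)))) (show zR 2 * (σ₁R ^ 4 * zR 1) = _ by ring)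

theorem z0_L {n : ℕ} {x : Rring} (hx : x ∈ Lsub n) : zR 0 * x ∈ Lsub (n + 1) :=
  L_cast (sub_mem (sub_mem (σ_L hx) (z1_L hx)) (z2_L hx)) (by unfold σ₁R; ring)

theorem mono_L (a b c : ℕ) : zR 0 ^ a * zR 1 ^ b * zR 2 ^ c ∈ Lsub (a + b + c) := by
  induction a with
  | succ a ih =>
    rw [show a + 1 + b + c = a + b + c + 1 by ring]
    exact L_cast (z0_L ih) (by ring)
  | zero =>
    induction b with
    | succ b ih =>
      rw [show 0 + (b + 1) + c = 0 + b + c + 1 by ring]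
      exact L_cast (z1_L ih) (by ring)
    | zero =>
      induction c with
      | succ c ih => exact L_cast (z2_L ih) (by ring)
      | zero => exact L_cast mX0 (by simp)

theorem S_le_L (n : ℕ) : Ssub n ≤ Lsub n := by
  refine Submodule.span_le.2 ?_
  rintro _ ⟨a, b, c, rfl, rfl⟩
  exact mono_L a b c

theorem la2_eq : 4 * la2 = p2R - 12 * zR 3 := by
  have h := Ring.mul_inverse_cancel _ isUnit_fourR
  unfold la2 p2R
  linear_combination (zR 0 - zR 1 + zR 2) ^ 2 * h

theorem la4_eq : 2 * la4 = p4R - 4 * zR 3 * la2 - 6 * zR 3 ^ 2 := by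
  have h := Ring.mul_inverse_cancel _ isUnit_twoR
  unfold la4 p4R
  linear_combination (zR 0 * zR 2 ^ 2 * (zR 0 - zR 1 + zR 2)) * h

theorem la6_eq : 4 * la6 = zR 0 ^ 2 * zR 2 ^ 4
    - 4 * (zR 3 * la4) - 4 * (zR 3 ^ 2 * la2) - 4 * zR 3 ^ 3 := by
  have h := Ring.mul_inverse_cancel _ isUnit_fourR
  unfold la6
  linear_combination (zR 0 ^ 2 * zR 2 ^ 4) * h

abbrev Idx : Type := Σ _ : Fin 16 × Fin 3, (Fin 3 →₀ ℕ)
abbrev Vmod : Type := Fin 16 × Fin 3 → Atilde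

noncomputable def Bas : Module.Basis Idx Z3loc Vmod :=
  Pi.basis fun _ => MvPolynomial.basisMonomials (Fin 3) Z3loc

/-- the structure map. -/
noncomputable def fmap : Vmod →ₗ[Z3loc] Rring :=
  ∑ ij : Fin 16 × Fin 3, (LinearMap.mulRight Z3loc (Xfam ij.1 * zR 3 ^ (ij.2 : ℕ))) ∘ₗ
    lam.toLinearMap ∘ₗ LinearMap.proj ij

theorem fmap_apply (c : Vmod) :
    fmap c = ∑ ij : Fin 16 × Fin 3, lam (c ij) * (Xfam ij.1 * zR 3 ^ (ij.2 : ℕ)) := by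
  simp [fmap, mul_assoc]

noncomputable def yel (i : Idx) : Rring :=
  la2 ^ (i.2 0) * la4 ^ (i.2 1) * la6 ^ (i.2 2) * (Xfam i.1.1 * zR 3 ^ (i.1.2 : ℕ))

theorem lam_monomial (α : Fin 3 →₀ ℕ) :
    lam (monomial α 1) = la2 ^ (α 0) * la4 ^ (α 1) * la6 ^ (α 2) := by
  unfold lam
  rw [aeval_monomial, map_one, one_mul, Finsupp.prod_fintype _ _ (by simp), Fin.prod_univ_three]
  rfl

theorem fmap_Bas (i : Idx) : fmap (Bas i) = yel i := by
  obtain ⟨ij, α⟩ := i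
  rw [fmap_apply, Finset.sum_eq_single ij]
  · simp [Bas, Pi.basis_apply, yel, lam_monomial]
  · intro b _ hb
    simp [Bas, Pi.basis_apply, hb]
  · simp

def wt (i : Idx) : ℕ := 2 * i.2 0 + 4 * i.2 1 + 6 * i.2 2 + degX i.1.1 + 2 * (i.1.2 : ℕ)

noncomputable def Wsub (d : ℕ) : Submodule Z3loc Rring :=
  Submodule.span Z3loc (yel '' {i | wt i = d})

theorem W_y (i : Idx) : yel i ∈ Wsub (wt i) := Submodule.subset_span ⟨i, rfl, rfl⟩

theorem W_mul_aux {z : Rring} {k : ℕ} (h : ∀ i, ∃ i', z * yel i = yel i' ∧ wt i' = wt i + k)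
    {n m : ℕ} (hm : n + k = m) {x : Rring} (hx : x ∈ Wsub n) : z * x ∈ Wsub m := by
  unfold Wsub at hx
  induction hx using Submodule.span_induction with
  | mem x hx =>
    obtain ⟨i, rfl, rfl⟩ := hx
    obtain ⟨i', h1, h2⟩ := h i
    rw [h1, ← hm, ← h2]
    exact W_y i'
  | zero => rw [mul_zero]; exact zero_mem _
  | add x y _ _ hx hy => rw [mul_add]; exact add_mem hx hy
  | smul c x _ hx => rw [mul_smul_comm]; exact Submodule.smul_mem _ _ hx

theorem W_la2 {n m : ℕ} (hm : n + 2 = m) {x : Rring} (hx : x ∈ Wsub n) : la2 * x ∈ Wsub m := by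
  refine W_mul_aux ?_ hm hx
  rintro ⟨ij, α⟩
  refine ⟨⟨ij, α + Finsupp.single 0 1⟩, ?_, ?_⟩
  · simp [yel]; ring
  · simp [wt]; ring

theorem W_la4 {n m : ℕ} (hm : n + 4 = m) {x : Rring} (hx : x ∈ Wsub n) : la4 * x ∈ Wsub m := by
  refine W_mul_aux ?_ hm hx
  rintro ⟨ij, α⟩
  refine ⟨⟨ij, α + Finsupp.single 1 1⟩, ?_, ?_⟩
  · simp [yel]; ring
  · simp [wt]; ring

theorem W_la6 {n m : ℕ} (hm : n + 6 = m) {x : Rring} (hx : x ∈ Wsub n) : la6 * x ∈ Wsub m := by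
  refine W_mul_aux ?_ hm hx
  rintro ⟨ij, α⟩
  refine ⟨⟨ij, α + Finsupp.single 2 1⟩, ?_, ?_⟩
  · simp [yel]; ring
  · simp [wt]; ring

noncomputable def Ksub (d : ℕ) : Submodule Z3loc Rring :=
  Wsub d ⊔ (Ideal.span {(3 : Z3loc)}) • Fsub d

theorem K_W {d : ℕ} {x : Rring} (hx : x ∈ Wsub d) : x ∈ Ksub d := Submodule.mem_sup_left hx

theorem K_3 {d : ℕ} {x : Rring} (hx : x ∈ Fsub d) : 3 * x ∈ Ksub d := by
  have : (3 : Rring) * x = (3 : Z3loc) • x := by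
    have h := Algebra.smul_def (3 : Z3loc) x
    rw [map_ofNat] at h
    exact h.symm
  rw [this]
  exact Submodule.mem_sup_right
    (Submodule.smul_mem_smul (Ideal.mem_span_singleton_self 3) hx)

theorem K_of_four {d : ℕ} {x : Rring} (hF : x ∈ Fsub d) (h : 4 * x ∈ Ksub d) : x ∈ Ksub d := by
  have e : x = 4 * x - 3 * x := by ring
  rw [e]
  exact sub_mem h (K_3 hF)

theorem nat_mem (N : Submodule Z3loc Rring) (c : ℕ) {x : Rring} (hx : x ∈ N) :
    (c : Rring) * x ∈ N := by
  rw [← nsmul_eq_mul]; exact nsmul_mem hx c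

theorem K_p2 {d e : ℕ} (IH : ∀ e < d, Fsub e ≤ Wsub e) (h : e + 2 = d) {f : Rring}
    (hf : f ∈ Fsub e) : p2R * f ∈ Ksub d := by
  have e1 : p2R * f = ((4 : ℕ) : Rring) * (la2 * f) + 3 * (((4 : ℕ) : Rring) * (zR 3 * f)) := by
    push_cast
    linear_combination (-f) * la2_eq
  rw [e1]
  exact add_mem (nat_mem _ _ (K_W (W_la2 h (IH e (by omega) hf))))
    (K_3 (nat_mem _ _ (F_mul (by omega) r_F hf)))

theorem K_p4 {d e : ℕ} (IH : ∀ e < d, Fsub e ≤ Wsub e) (h : e + 4 = d) {f : Rring}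
    (hf : f ∈ Fsub e) : p4R * f ∈ Ksub d := by
  have hrf : zR 3 * f ∈ Fsub (e + 2) := F_mul (by omega) r_F hf
  have hrrf : zR 3 * (zR 3 * f) ∈ Fsub d := F_mul (by omega) r_F hrf
  have e1 : p4R * f = ((2 : ℕ) : Rring) * (la4 * f) + ((4 : ℕ) : Rring) * (la2 * (zR 3 * f))
      + 3 * (((2 : ℕ) : Rring) * (zR 3 * (zR 3 * f))) := by
    push_cast
    linear_combination (-f) * la4_eq
  rw [e1]
  exact add_mem (add_mem (nat_mem _ _ (K_W (W_la4 h (IH e (by omega) hf))))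
    (nat_mem _ _ (K_W (W_la2 (by omega) (IH _ (by omega) hrf)))))
    (K_3 (nat_mem _ _ hrrf))

theorem K_p6 {d e : ℕ} (IH : ∀ e < d, Fsub e ≤ Wsub e) (h : e + 6 = d) {f : Rring}
    (hf : f ∈ Fsub e) (h0 : zR 0 ^ 2 * zR 2 ^ 4 * f ∈ Ksub d) : 4 * (zR 3 ^ 3 * f) ∈ Ksub d := by
  have hrf : zR 3 * f ∈ Fsub (e + 2) := F_mul (by omega) r_F hf
  have hrrf : zR 3 * (zR 3 * f) ∈ Fsub (e + 4) := F_mul (by omega) r_F hrf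
  have e1 : 4 * (zR 3 ^ 3 * f) = zR 0 ^ 2 * zR 2 ^ 4 * f - ((4 : ℕ) : Rring) * (la6 * f)
      - ((4 : ℕ) : Rring) * (la4 * (zR 3 * f))
      - ((4 : ℕ) : Rring) * (la2 * (zR 3 * (zR 3 * f))) := by
    push_cast
    linear_combination f * la6_eq
  rw [e1]
  exact sub_mem (sub_mem (sub_mem h0
    (nat_mem _ _ (K_W (W_la6 h (IH e (by omega) hf)))))
    (nat_mem _ _ (K_W (W_la4 (by omega) (IH _ (by omega) hrf)))))
    (nat_mem _ _ (K_W (W_la2 (by omega) (IH _ (by omega) hrrf))))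

theorem rpow_F (j : ℕ) : zR 3 ^ j ∈ Fsub (2 * j) :=
  Submodule.subset_span ⟨0, 0, 0, j, by omega, by simp⟩

theorem K_L {d : ℕ} (IH : ∀ e < d, Fsub e ≤ Wsub e) (j : Fin 3) {n : ℕ}
    (hn : n + 2 * (j : ℕ) = d) {x : Rring} (hx : x ∈ Lsub n) : x * zR 3 ^ (j : ℕ) ∈ Ksub d := by
  have hr := rpow_F (j : ℕ)
  unfold Lsub at hx
  induction hx using Submodule.span_induction with
  | mem x hx =>
    rcases hx with ((⟨i, rfl, rfl⟩ | ⟨f, hf, rfl⟩) | ⟨e, rfl, f, hf, rfl⟩) | ⟨e, rfl, f, hf, rfl⟩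
    · have := W_y ⟨(i, j), 0⟩
      simp only [yel, wt, Finsupp.coe_zero, Pi.zero_apply, pow_zero, mul_one, one_mul, mul_zero,
        zero_add, hn] at this
      exact K_W this
    · rw [mul_assoc]; exact K_3 (F_mul hn (S_le_F _ hf) hr)
    · rw [mul_assoc]
      exact K_p2 IH (e := e + 2 * (j : ℕ)) (by omega) (F_mul rfl (S_le_F _ hf) hr)
    · rw [mul_assoc]
      exact K_p4 IH (e := e + 2 * (j : ℕ)) (by omega) (F_mul rfl (S_le_F _ hf) hr)
  | zero => rw [zero_mul]; exact zero_mem _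
  | add x y _ _ hx hy => rw [add_mul]; exact add_mem hx hy
  | smul c x _ hx => rw [smul_mul_assoc]; exact Submodule.smul_mem _ _ hx

theorem K_all {d : ℕ} (IH : ∀ e < d, Fsub e ≤ Wsub e) (j : ℕ) : ∀ {n : ℕ},
    n + 2 * j = d → ∀ {x : Rring}, x ∈ Ssub n → x * zR 3 ^ j ∈ Ksub d := by
  induction j using Nat.strong_induction_on with
  | _ j ih =>
    intro n hn x hx
    by_cases hj : j < 3
    · exact K_L IH ⟨j, hj⟩ hn (S_le_L n hx)
    · obtain ⟨k, rfl⟩ := Nat.exists_eq_add_of_le' (not_lt.1 hj)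
      have hF : x * zR 3 ^ (k + 3) ∈ Fsub d := F_mul hn (S_le_F _ hx) (rpow_F _)
      refine K_of_four hF ?_
      have e1 : x * zR 3 ^ (k + 3) = zR 3 ^ 3 * (x * zR 3 ^ k) := by ring
      rw [e1]
      refine K_p6 IH (e := n + 2 * k) (by omega) (F_mul rfl (S_le_F _ hx) (rpow_F _)) ?_
      have e2 : zR 0 ^ 2 * zR 2 ^ 4 * (x * zR 3 ^ k) = (zR 0 ^ 2 * zR 2 ^ 4 * x) * zR 3 ^ k := by
        ring
      rw [e2]
      have h6 : zR 0 ^ 2 * zR 2 ^ 4 ∈ Ssub 6 :=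
        S_mul (m := 2) (n := 4) (by omega) (S_pow z0_S 2) (S_pow z2_S 4)
      have h7 : zR 0 ^ 2 * zR 2 ^ 4 * x ∈ Ssub (n + 6) := S_mul (by omega) h6 hx
      exact ih k (by omega) (by omega) h7

theorem F_fg (d : ℕ) : (Fsub d).FG := by
  refine Submodule.fg_span (Set.Finite.subset (Set.finite_range
    (fun q : Fin (d + 1) × Fin (d + 1) × Fin (d + 1) × Fin (d + 1) =>
      zR 0 ^ (q.1 : ℕ) * zR 1 ^ (q.2.1 : ℕ) * zR 2 ^ (q.2.2.1 : ℕ) * zR 3 ^ (q.2.2.2 : ℕ))) ?_)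
  rintro _ ⟨a, b, c, e, h, rfl⟩
  exact ⟨(⟨a, by omega⟩, ⟨b, by omega⟩, ⟨c, by omega⟩, ⟨e, by omega⟩), rfl⟩

theorem F_le_W (d : ℕ) : Fsub d ≤ Wsub d := by
  induction d using Nat.strong_induction_on with
  | _ d IH =>
    refine Submodule.le_of_le_smul_of_le_jacobson_bot (I := Ideal.span {(3 : Z3loc)})
      (F_fg d) ?_ ?_
    · rw [IsLocalRing.jacobson_eq_maximalIdeal _ bot_ne_top, Ideal.span_le]
      simpa using three_mem_max
    · change Fsub d ≤ Ksub d
      refine Submodule.span_le.2 ?_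
      rintro _ ⟨a, b, c, e, h, rfl⟩
      exact K_all IH e h (Submodule.subset_span ⟨a, b, c, rfl, rfl⟩)

theorem F_of_unit_smul {d : ℕ} (n : ℕ) (hn : IsUnit ((n : ℕ) : Z3loc)) {x : Rring}
    (h : ((n : ℕ) : Rring) * x ∈ Fsub d) : x ∈ Fsub d := by
  obtain ⟨u, hu⟩ := hn
  have e : x = ((u⁻¹ : Z3locˣ) : Z3loc) • (((n : ℕ) : Rring) * x) := by
    have h1 : ((n : ℕ) : Rring) * x = ((n : ℕ) : Z3loc) • x := by
      have h := Algebra.smul_def ((n : ℕ) : Z3loc) x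
      rw [map_natCast] at h
      exact h.symm
    rw [h1, ← hu, smul_smul, Units.inv_mul, one_smul]
  rw [e]
  exact Submodule.smul_mem _ _ h

theorem unit2 : IsUnit ((2 : ℕ) : Z3loc) := by exact_mod_cast isUnit_two
theorem unit4 : IsUnit ((4 : ℕ) : Z3loc) := by
  have := unit2.mul unit2
  rw [← Nat.cast_mul] at this
  exact this

theorem F_pow {x : Rring} {d : ℕ} (hx : x ∈ Fsub d) (n : ℕ) : x ^ n ∈ Fsub (d * n) := by
  induction n with
  | zero => simpa using one_F
  | succ n ih => rw [pow_succ]; exact F_mul (by ring) ih hx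

theorem p2_F : p2R ∈ Fsub 2 := by
  refine S_le_F _ ?_
  have h1 : zR 0 - zR 1 + zR 2 ∈ Ssub 1 := add_mem (sub_mem z0_S z1_S) z2_S
  unfold p2R
  refine sub_mem ?_ ?_
  · rw [sq]; exact S_mul (m := 1) (n := 1) (by omega) h1 h1
  · have h2 : zR 1 * zR 2 ∈ Ssub 2 := S_mul (m := 1) (n := 1) (by omega) z1_S z2_S
    have h3 := nat_mem _ 4 h2
    rw [Nat.cast_ofNat] at h3
    exact h3

theorem p4_F : p4R ∈ Fsub 4 := by
  refine S_le_F _ ?_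
  have h1 : zR 0 - zR 1 + zR 2 ∈ Ssub 1 := add_mem (sub_mem z0_S z1_S) z2_S
  unfold p4R
  have h2 : zR 0 * zR 2 ^ 2 ∈ Ssub 3 := S_mul (m := 1) (n := 2) (by omega) z0_S (S_pow z2_S 2)
  exact S_mul (m := 3) (n := 1) (by omega) h2 h1

theorem la2_F : la2 ∈ Fsub 2 := by
  refine F_of_unit_smul 4 unit4 ?_
  have e : ((4 : ℕ) : Rring) * la2 = p2R - ((12 : ℕ) : Rring) * zR 3 := by
    push_cast; exact la2_eq
  rw [e]
  exact sub_mem p2_F (nat_mem _ _ r_F)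

theorem la4_F : la4 ∈ Fsub 4 := by
  refine F_of_unit_smul 2 unit2 ?_
  have e : ((2 : ℕ) : Rring) * la4 =
      p4R - ((4 : ℕ) : Rring) * (zR 3 * la2) - ((6 : ℕ) : Rring) * zR 3 ^ 2 := by
    push_cast; rw [la4_eq]; ring
  rw [e]
  exact sub_mem (sub_mem p4_F (nat_mem _ _ (F_mul (m := 2) (n := 2) rfl r_F la2_F)))
    (nat_mem _ _ (rpow_F 2))

theorem la6_F : la6 ∈ Fsub 6 := by
  refine F_of_unit_smul 4 unit4 ?_
  have e : ((4 : ℕ) : Rring) * la6 = zR 0 ^ 2 * zR 2 ^ 4 - ((4 : ℕ) : Rring) * (zR 3 * la4)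
      - ((4 : ℕ) : Rring) * (zR 3 ^ 2 * la2) - ((4 : ℕ) : Rring) * zR 3 ^ 3 := by
    push_cast; exact la6_eq
  rw [e]
  refine sub_mem (sub_mem (sub_mem ?_ (nat_mem _ _ ?_)) (nat_mem _ _ ?_)) (nat_mem _ _ (rpow_F 3))
  · exact S_le_F _ (S_mul (m := 2) (n := 4) rfl (S_pow z0_S 2) (S_pow z2_S 4))
  · exact F_mul (m := 2) (n := 4) rfl r_F la4_F
  · exact F_mul (m := 4) (n := 2) rfl (rpow_F 2) la2_F

theorem X_F (i : Fin 16) : Xfam i ∈ Fsub (degX i) := by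
  refine S_le_F _ ?_
  have h2 := fun n => S_pow σ_S n
  fin_cases i
  · exact one_S
  · exact σ_S
  · exact z1_S
  · exact z2_S
  · exact h2 2
  · exact S_mul (m := 1) (n := 1) rfl σ_S z1_S
  · exact S_mul (m := 1) (n := 1) rfl σ_S z2_S
  · exact S_mul (m := 1) (n := 1) rfl z1_S z2_S
  · exact h2 3
  · exact S_mul (m := 2) (n := 1) rfl (h2 2) z1_S
  · exact S_mul (m := 2) (n := 1) rfl (h2 2) z2_S
  · exact S_mul (m := 2) (n := 1) rfl (S_mul (m := 1) (n := 1) rfl z0_S z1_S) z2_S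
  · exact h2 4
  · exact S_mul (m := 3) (n := 1) rfl (h2 3) z1_S
  · exact S_mul (m := 3) (n := 1) rfl (h2 3) z2_S
  · exact S_mul (m := 4) (n := 1) rfl (h2 4) z1_S

theorem y_F (i : Idx) : yel i ∈ Fsub (wt i) := by
  have h1 := F_mul rfl (F_mul rfl (F_pow la2_F (i.2 0)) (F_pow la4_F (i.2 1)))
    (F_pow la6_F (i.2 2))
  have h2 := F_mul rfl (X_F i.1.1) (rpow_F (i.1.2 : ℕ))
  exact F_mul (by unfold wt; omega) h1 h2

/-- the parametrization of the conic: `z₁ = a(a+b)`, `z₂ = b(a+b)`, `z₃ = -ab`. -/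
noncomputable def ψ0 : MvPolynomial (Fin 4) Z3loc →ₐ[Z3loc] Atilde :=
  aeval ![X 0 * (X 0 + X 1), X 1 * (X 0 + X 1), -(X 0 * X 1), X 2]

noncomputable def ψ : Rring →ₐ[Z3loc] Atilde :=
  Ideal.Quotient.liftₐ _ ψ0 (by
    intro a ha
    obtain ⟨b, rfl⟩ := Ideal.mem_span_singleton'.1 ha
    rw [map_mul]
    refine mul_eq_zero_of_right _ ?_
    simp [ψ0]
    ring)

theorem ψ_z (i : Fin 4) : ψ (zR i) = ψ0 (X i) := rfl
theorem ψ_z0 : ψ (zR 0) = X 0 * (X 0 + X 1) := by simp [ψ_z, ψ0]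
theorem ψ_z1 : ψ (zR 1) = X 1 * (X 0 + X 1) := by simp [ψ_z, ψ0]
theorem ψ_z2 : ψ (zR 2) = -(X 0 * X 1) := by simp [ψ_z, ψ0]
theorem ψ_z3 : ψ (zR 3) = X 2 := by simp [ψ_z, ψ0]

noncomputable def Psub (d : ℕ) : Submodule Z3loc Atilde :=
  Submodule.span Z3loc {x | ∃ s : Fin 3 →₀ ℕ, s 0 + s 1 + 4 * s 2 = 2 * d ∧ x = monomial s 1}

theorem P_mul {m n k : ℕ} (h : m + n = k) {x y : Atilde} (hx : x ∈ Psub m) (hy : y ∈ Psub n) :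
    x * y ∈ Psub k := by
  have := Submodule.mul_mem_mul hx hy
  unfold Psub at this
  rw [Submodule.span_mul_span] at this
  refine Submodule.span_mono ?_ this
  rintro _ ⟨_, ⟨s, h1, rfl⟩, _, ⟨s', h2, rfl⟩, rfl⟩
  refine ⟨s + s', ?_, ?_⟩
  · simp only [Finsupp.add_apply]; omega
  · simp [monomial_mul]

theorem P_one : (1 : Atilde) ∈ Psub 0 := Submodule.subset_span ⟨0, by simp, rfl⟩

theorem P_pow {x : Atilde} {d : ℕ} (hx : x ∈ Psub d) (n : ℕ) : x ^ n ∈ Psub (d * n) := by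
  induction n with
  | zero => simpa using P_one
  | succ n ih => rw [pow_succ]; exact P_mul (by ring) ih hx

theorem P_XX (i j : Fin 3) (hi : i ≠ 2) (hj : j ≠ 2) : (X i * X j : Atilde) ∈ Psub 1 := by
  refine Submodule.subset_span ⟨Finsupp.single i 1 + Finsupp.single j 1, ?_, ?_⟩
  · fin_cases i <;> fin_cases j <;> simp at hi hj ⊢
  · simp [X, monomial_mul]

theorem P_X2 : (X 2 : Atilde) ∈ Psub 2 := by
  refine Submodule.subset_span ⟨Finsupp.single 2 1, ?_, rfl⟩
  simp

theorem ψ_F (d : ℕ) {x : Rring} (hx : x ∈ Fsub d) : ψ x ∈ Psub d := by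
  have h00 := P_XX 0 0 (by decide) (by decide)
  have h01 := P_XX 0 1 (by decide) (by decide)
  have h10 := P_XX 1 0 (by decide) (by decide)
  have h11 := P_XX 1 1 (by decide) (by decide)
  have g0 : ψ (zR 0) ∈ Psub 1 := by rw [ψ_z0, mul_add]; exact add_mem h00 h01
  have g1 : ψ (zR 1) ∈ Psub 1 := by rw [ψ_z1, mul_add]; exact add_mem h10 h11
  have g2 : ψ (zR 2) ∈ Psub 1 := by rw [ψ_z2]; exact neg_mem h01
  have g3 : ψ (zR 3) ∈ Psub 2 := by rw [ψ_z3]; exact P_X2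
  unfold Fsub at hx
  induction hx using Submodule.span_induction with
  | mem x hx =>
    obtain ⟨a, b, c, e, h, rfl⟩ := hx
    simp only [map_mul, map_pow]
    exact P_mul (by omega) (P_mul rfl (P_mul rfl (P_pow g0 a) (P_pow g1 b)) (P_pow g2 c))
      (P_pow g3 e)
  | zero => rw [map_zero]; exact zero_mem _
  | add x y _ _ hx hy => rw [map_add]; exact add_mem hx hy
  | smul c x _ hx => rw [map_smul]; exact Submodule.smul_mem _ _ hx

def pp : Fin 16 → ℕ := ![0, 1, 0, 0, 1, 1, 0, 0, 1, 1, 0, 0, 1, 1, 0, 1]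
def qq : Fin 16 → ℕ := ![0, 0, 1, 0, 1, 0, 1, 2, 1, 2, 2, 3, 2, 3, 3, 3]
def ee : Fin 16 → ℕ := ![0, 0, 0, 1, 0, 1, 1, 0, 1, 0, 1, 0, 1, 0, 1, 1]

theorem tab_sum : ∀ i, degX i = pp i + qq i + ee i := by decide
theorem tab_bd : ∀ i, pp i < 2 ∧ qq i < 4 ∧ ee i < 2 := by decide
theorem tab_inj : ∀ i j, pp i = pp j → qq i = qq j → ee i = ee j → i = j := by decide

noncomputable def tt (i : Idx) : Fin 3 →₀ ℕ :=
  Finsupp.equivFunOnFinite.symm ![2 * (2 * i.2 0 + pp i.1.1) + ee i.1.1,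
    2 * (4 * i.2 1 + qq i.1.1) + ee i.1.1, 3 * i.2 2 + (i.1.2 : ℕ)]

theorem tt0 (i : Idx) : tt i 0 = 2 * (2 * i.2 0 + pp i.1.1) + ee i.1.1 := rfl
theorem tt1 (i : Idx) : tt i 1 = 2 * (4 * i.2 1 + qq i.1.1) + ee i.1.1 := rfl
theorem tt2 (i : Idx) : tt i 2 = 3 * i.2 2 + (i.1.2 : ℕ) := rfl

theorem tt_inj : Function.Injective tt := by
  rintro ⟨⟨i, j⟩, α⟩ ⟨⟨i', j'⟩, α'⟩ h
  have h0 := congrArg (fun s => s 0) h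
  have h1 := congrArg (fun s => s 1) h
  have h2 := congrArg (fun s => s 2) h
  simp only [tt0, tt1, tt2] at h0 h1 h2
  obtain ⟨b1, b2, b3⟩ := tab_bd i
  obtain ⟨b1', b2', b3'⟩ := tab_bd i'
  have b4 := j.2
  have b4' := j'.2
  have hi : i = i' := tab_inj i i' (by omega) (by omega) (by omega)
  subst hi
  have hj : j = j' := Fin.ext (by omega)
  subst hj
  have hα : α = α' := by
    ext k
    fin_cases k
    · change α 0 = α' 0; omega
    · change α 1 = α' 1; omega
    · change α 2 = α' 2; omega
  subst hα
  rfl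

theorem tt_wt (i : Idx) : tt i 0 + tt i 1 + 4 * tt i 2 = 2 * wt i := by
  rw [tt0, tt1, tt2, wt, tab_sum]; ring

theorem mono_tt (i : Idx) : ∃ x ∈ Fsub (wt i), ψ x = monomial (tt i) 1 := by
  set p := 2 * i.2 0 + pp i.1.1 with hp
  set q := 4 * i.2 1 + qq i.1.1 with hq
  set ε := ee i.1.1 with hε
  have hw : wt i = 1 * p + 1 * q + 1 * ε + 2 * tt i 2 := by
    have h := tt_wt i
    rw [tt0, tt1] at h
    omega
  have g0 : zR 0 + zR 2 ∈ Fsub 1 := S_le_F _ (add_mem z0_S z2_S)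
  have g1 : zR 1 + zR 2 ∈ Fsub 1 := S_le_F _ (add_mem z1_S z2_S)
  have g2 : -zR 2 ∈ Fsub 1 := S_le_F _ (neg_mem z2_S)
  refine ⟨(zR 0 + zR 2) ^ p * (zR 1 + zR 2) ^ q * (-zR 2) ^ ε * zR 3 ^ (tt i 2), ?_, ?_⟩
  · rw [hw]
    exact F_mul rfl (F_mul rfl (F_mul rfl (F_pow g0 p) (F_pow g1 q)) (F_pow g2 ε)) (rpow_F _)
  · simp only [map_mul, map_pow, map_add, map_neg, ψ_z0, ψ_z1, ψ_z2, ψ_z3]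
    rw [monomial_eq, C_1, one_mul, Finsupp.prod_fintype _ _ (by simp), Fin.prod_univ_three,
      tt0, tt1, ← hp, ← hq, ← hε]
    have e0 : (X 0 * (X 0 + X 1) + -(X 0 * X 1) : Atilde) = X 0 ^ 2 := by ring
    have e1 : (X 1 * (X 0 + X 1) + -(X 0 * X 1) : Atilde) = X 1 ^ 2 := by ring
    rw [e0, e1, neg_neg, ← pow_mul, ← pow_mul, mul_pow, pow_add, pow_add]
    ring

open Classical in
noncomputable def Θ : Atilde →ₗ[Z3loc] Vmod :=
  (MvPolynomial.basisMonomials (Fin 3) Z3loc).constr Z3loc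
    (fun s => if h : ∃ i, tt i = s then Bas h.choose else 0)

theorem Θ_mono (s : Fin 3 →₀ ℕ) : Θ (monomial s 1) =
    open Classical in (if h : ∃ i, tt i = s then Bas h.choose else 0) := by
  have h := (MvPolynomial.basisMonomials (Fin 3) Z3loc).constr_basis Z3loc
    (open Classical in fun s => if h : ∃ i, tt i = s then Bas h.choose else 0) s
  rw [coe_basisMonomials] at h
  exact h

theorem Θ_tt (i : Idx) : Θ (monomial (tt i) 1) = Bas i := by
  rw [Θ_mono]
  have h : ∃ j, tt j = tt i := ⟨i, rfl⟩
  rw [dif_pos h, tt_inj h.choose_spec]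

noncomputable def Vsub (d : ℕ) : Submodule Z3loc Vmod :=
  Submodule.span Z3loc (Bas '' {i | wt i ≤ d})

theorem Θ_P {d e : ℕ} (hde : d ≤ e) {x : Atilde} (hx : x ∈ Psub d) : Θ x ∈ Vsub e := by
  unfold Psub at hx
  induction hx using Submodule.span_induction with
  | mem x hx =>
    obtain ⟨s, h, rfl⟩ := hx
    rw [Θ_mono]
    split_ifs with hs
    · refine Submodule.subset_span ⟨_, ?_, rfl⟩
      have h1 := tt_wt hs.choose
      rw [hs.choose_spec, h] at h1
      change wt _ ≤ e
      omega
    · exact zero_mem _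
  | zero => rw [map_zero]; exact zero_mem _
  | add x y _ _ hx hy => rw [map_add]; exact add_mem hx hy
  | smul c x _ hx => rw [map_smul]; exact Submodule.smul_mem _ _ hx

noncomputable def gmap : Vmod →ₗ[Z3loc] Vmod := Θ ∘ₗ ψ.toLinearMap ∘ₗ fmap

theorem gmap_apply (v : Vmod) : gmap v = Θ (ψ (fmap v)) := rfl

theorem g_maps (d : ℕ) : ∀ v ∈ Vsub d, gmap v ∈ Vsub d := by
  intro v hv
  unfold Vsub at hv
  induction hv using Submodule.span_induction with
  | mem x hx =>
    obtain ⟨i, hi, rfl⟩ := hx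
    rw [gmap_apply, fmap_Bas]
    exact Θ_P hi (ψ_F _ (y_F i))
  | zero => rw [map_zero]; exact zero_mem _
  | add x y _ _ hx hy => rw [map_add]; exact add_mem hx hy
  | smul c x _ hx => rw [map_smul]; exact Submodule.smul_mem _ _ hx

theorem W_le {d e : ℕ} (hde : d ≤ e) : Wsub d ≤ (Vsub e).map fmap := by
  refine Submodule.span_le.2 ?_
  rintro _ ⟨i, hi, rfl⟩
  refine ⟨Bas i, Submodule.subset_span ⟨i, ?_, rfl⟩, fmap_Bas i⟩
  change wt i = d at hi
  change wt i ≤ e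
  omega

theorem g_surj (d : ℕ) : Vsub d ≤ (Vsub d).map gmap := by
  refine Submodule.span_le.2 ?_
  rintro _ ⟨i, hi, rfl⟩
  obtain ⟨x, hx, hψ⟩ := mono_tt i
  obtain ⟨v, hv, rfl⟩ := W_le hi (F_le_W _ hx)
  exact ⟨v, hv, by rw [gmap_apply, hψ, Θ_tt]⟩

theorem V_fin (d : ℕ) : Module.Finite Z3loc (Vsub d) := by
  refine Module.Finite.iff_fg.2 (Submodule.fg_span (Set.Finite.image _ ?_))
  refine Set.Finite.subset (Set.finite_range
    (fun q : (Fin 16 × Fin 3) × (Fin 3 → Fin (d + 1)) =>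
      (⟨q.1, Finsupp.equivFunOnFinite.symm fun k => (q.2 k : ℕ)⟩ : Idx))) ?_
  rintro ⟨ij, α⟩ h
  change wt _ ≤ d at h
  simp only [wt] at h
  refine ⟨(ij, fun k => ⟨α k, ?_⟩), ?_⟩
  · fin_cases k
    · change α 0 < d + 1; omega
    · change α 1 < d + 1; omega
    · change α 2 < d + 1; omega
  · have : (Finsupp.equivFunOnFinite.symm fun k => α k) = α := by ext; rfl
    exact congrArg (Sigma.mk ij) this

theorem orzech_aux {K V : Type*} [CommRing K] [AddCommGroup V] [Module K V] (N : Submodule K V)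
    (hfin : Module.Finite K N) (g : V →ₗ[K] V) (h1 : ∀ v ∈ N, g v ∈ N) (h2 : N ≤ N.map g)
    (v : V) (hv : v ∈ N) (h : g v = 0) : v = 0 := by
  have hs : Function.Surjective (g.restrict h1) := by
    rintro ⟨w, hw⟩
    obtain ⟨v, hv, e⟩ := h2 hw
    exact ⟨⟨v, hv⟩, Subtype.ext e⟩
  have hi := OrzechProperty.injective_of_surjective_endomorphism _ hs
  have h0 : (⟨v, hv⟩ : N) = 0 := hi (by
    rw [map_zero]
    exact Subtype.ext h)
  exact congrArg Subtype.val h0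

theorem g_inj (d : ℕ) (v : Vmod) (hv : v ∈ Vsub d) (h : gmap v = 0) : v = 0 :=
  orzech_aux (Vsub d) (V_fin d) gmap (g_maps d) (g_surj d) v hv h

theorem f_inj : Function.Injective fmap := by
  rw [injective_iff_map_eq_zero]
  intro v h
  refine g_inj ((Bas.repr v).support.sup wt) v ?_ (by rw [gmap_apply, h, map_zero, map_zero])
  refine Bas.mem_span_image.2 ?_
  intro i hi
  exact Finset.le_sup (f := wt) hi

theorem f_surj : Function.Surjective fmap := by
  intro x
  obtain ⟨p, rfl⟩ := Ideal.Quotient.mk_surjective x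
  change Ideal.Quotient.mk _ p ∈ LinearMap.range fmap
  induction p using MvPolynomial.induction_on' with
  | monomial s c =>
    have h : (zR 0 ^ s 0 * zR 1 ^ s 1 * zR 2 ^ s 2 * zR 3 ^ s 3) ∈ LinearMap.range fmap := by
      have h1 := W_le le_rfl (F_le_W _ (Submodule.subset_span ⟨s 0, s 1, s 2, s 3, rfl, rfl⟩))
      obtain ⟨v, _, hv⟩ := h1
      exact ⟨v, hv⟩
    have e : (Ideal.Quotient.mk _ (monomial s c) : Rring) =
        c • (zR 0 ^ s 0 * zR 1 ^ s 1 * zR 2 ^ s 2 * zR 3 ^ s 3) := by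
      have e1 : (monomial s c : MvPolynomial (Fin 4) Z3loc) =
          c • (X 0 ^ s 0 * X 1 ^ s 1 * X 2 ^ s 2 * X 3 ^ s 3) := by
        rw [monomial_eq, Finsupp.prod_fintype _ _ (by simp), Fin.prod_univ_four, smul_eq_C_mul]
      rw [e1]
      rfl
    rw [e]
    exact Submodule.smul_mem _ _ h
  | add p q hp hq => rw [map_add]; exact add_mem hp hq

/-- `R = ℤ_(3)[z₁,z₂,z₃,r]/(z₁z₂+z₂z₃+z₃z₁)` is a free `Ã = ℤ_(3)[ā₂,ā₄,ā₆]`-module of rank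
`48` (with `Ã` acting through `λ`), with basis `X ⊔ X·r ⊔ X·r²`: every element of `R` has a
unique representation `∑_{(i,j)} λ(c_{i,j}) · X_i · r^j` with coefficients `c_{i,j} ∈ Ã`. -/
theorem Rring_free_of_rank_48 :
    ∀ x : Rring, ∃! c : Fin 16 × Fin 3 → Atilde,
      x = ∑ ij : Fin 16 × Fin 3, lam (c ij) * (Xfam ij.1 * zR 3 ^ (ij.2 : ℕ)) := by
  intro x
  obtain ⟨c, hc⟩ := f_surj x
  refine ⟨c, ?_, ?_⟩
  · change x = _
    rw [← hc, fmap_apply]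
  · intro c' hc'
    apply f_inj
    rw [hc, fmap_apply]
    exact hc'.symm
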